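/- For every m ≥ 1 and each index j ∈ {1,…,m}, the operators Y_{jj} := x_j∂_{y_j} − (1/2)∂_{z_j}² and Z_{jj} := y_j∂_{x_j} + (1/2)(multiplication by z_j²) satisfy [Y_{jj}, Z_{jj}] = X_{jj}, where X_{jj} := x_j∂_{x_j} − y_j∂_{y_j} − z_j∂_{z_j} − (1/2)·id. -/

import Mathlib

open MvPolynomial Finset

noncomputable section

/-- Polynomials in 3m variables x_1..x_m, y_1..y_m, z_1..z_m. -/
abbrev PS (m : ℕ) : Type := MvPolynomial (Fin m ⊕ Fin m ⊕ Fin m) ℂ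

variable (m : ℕ)

/-- partial derivative ∂_{x_j} -/
def dx (j : Fin m) : Module.End ℂ (PS m) := (pderiv (Sum.inl j)).toLinearMap
/-- partial derivative ∂_{y_j} -/
def dy (j : Fin m) : Module.End ℂ (PS m) := (pderiv (Sum.inr (Sum.inl j))).toLinearMap
/-- partial derivative ∂_{z_j} -/
def dz (j : Fin m) : Module.End ℂ (PS m) := (pderiv (Sum.inr (Sum.inr j))).toLinearMap
/-- multiplication by x_j -/
def mx (j : Fin m) : Module.End ℂ (PS m) := LinearMap.mulLeft ℂ (X (Sum.inl j))
/-- multiplication by y_j -/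
def my (j : Fin m) : Module.End ℂ (PS m) := LinearMap.mulLeft ℂ (X (Sum.inr (Sum.inl j)))
/-- multiplication by z_j -/
def mz (j : Fin m) : Module.End ℂ (PS m) := LinearMap.mulLeft ℂ (X (Sum.inr (Sum.inr j)))

/-- symplectic Dirac operator D_s = ⟨z,∂_y⟩ − ⟨∂_z,∂_x⟩ -/
def Ds : Module.End ℂ (PS m) := (∑ j, mz m j * dy m j) - ∑ j, dz m j * dx m j
/-- adjoint X_s = ⟨y,∂_z⟩ + ⟨x,z⟩ -/
def Xs : Module.End ℂ (PS m) := (∑ j, my m j * dz m j) + ∑ j, mx m j * mz m j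
/-- Euler operator in x -/
def Ex : Module.End ℂ (PS m) := ∑ j, mx m j * dx m j
/-- Euler operator in y -/
def Ey : Module.End ℂ (PS m) := ∑ j, my m j * dy m j
/-- Euler operator in z -/
def Ez : Module.End ℂ (PS m) := ∑ j, mz m j * dz m j
/-- Δ_x -/
def lapX : Module.End ℂ (PS m) := ∑ j, dx m j * dx m j
/-- Δ_y -/
def lapY : Module.End ℂ (PS m) := ∑ j, dy m j * dy m j
/-- Δ_z -/
def lapZ : Module.End ℂ (PS m) := ∑ j, dz m j * dz m j
/-- ⟨∂_x,∂_y⟩ -/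
def dxdy : Module.End ℂ (PS m) := ∑ j, dx m j * dy m j
/-- ⟨∂_y,∂_z⟩ -/
def dydz : Module.End ℂ (PS m) := ∑ j, dy m j * dz m j
/-- ⟨∂_x,∂_z⟩ = ⟨∂_z,∂_x⟩ -/
def dxdz : Module.End ℂ (PS m) := ∑ j, dx m j * dz m j
/-- ⟨x,∂_y⟩ -/
def xdy : Module.End ℂ (PS m) := ∑ j, mx m j * dy m j
/-- ⟨y,∂_x⟩ -/
def ydx : Module.End ℂ (PS m) := ∑ j, my m j * dx m j
/-- ⟨x,∂_z⟩ -/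
def xdz : Module.End ℂ (PS m) := ∑ j, mx m j * dz m j
/-- ⟨z,∂_x⟩ -/
def zdx : Module.End ℂ (PS m) := ∑ j, mz m j * dx m j
/-- ⟨y,∂_z⟩ -/
def ydz : Module.End ℂ (PS m) := ∑ j, my m j * dz m j
/-- ⟨z,∂_y⟩ -/
def zdy : Module.End ℂ (PS m) := ∑ j, mz m j * dy m j
/-- multiplication by |x|² -/
def nx2 : Module.End ℂ (PS m) := ∑ j, mx m j * mx m j
/-- multiplication by |y|² -/
def ny2 : Module.End ℂ (PS m) := ∑ j, my m j * my m j
/-- multiplication by |z|² -/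
def nz2 : Module.End ℂ (PS m) := ∑ j, mz m j * mz m j
/-- multiplication by ⟨x,y⟩ -/
def mxy : Module.End ℂ (PS m) := ∑ j, mx m j * my m j
/-- multiplication by ⟨y,z⟩ -/
def myz : Module.End ℂ (PS m) := ∑ j, my m j * mz m j
/-- multiplication by ⟨x,z⟩ -/
def mxz : Module.End ℂ (PS m) := ∑ j, mx m j * mz m j
/-- L = ⟨x,∂_y⟩ − (1/2)Δ_z -/
def Lop : Module.End ℂ (PS m) := xdy m - (1/2 : ℂ) • lapZ m
/-- R = ⟨y,∂_x⟩ + (1/2)|z|² -/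
def Rop : Module.End ℂ (PS m) := ydx m + (1/2 : ℂ) • nz2 m

/-- Y_{jj} := x_j∂_{y_j} − (1/2)∂_{z_j}² -/
def Yjj (j : Fin m) : Module.End ℂ (PS m) := mx m j * dy m j - (1/2 : ℂ) • (dz m j * dz m j)

/-- Z_{jj} := y_j∂_{x_j} + (1/2)z_j² -/
def Zjj (j : Fin m) : Module.End ℂ (PS m) := my m j * dx m j + (1/2 : ℂ) • (mz m j * mz m j)

/-- X_{jj} := x_j∂_{x_j} − y_j∂_{y_j} − z_j∂_{z_j} − (1/2)·id -/
def Xjj (j : Fin m) : Module.End ℂ (PS m) :=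
  mx m j * dx m j - my m j * dy m j - mz m j * dz m j - (1/2 : ℂ) • 1

/-- Partial derivatives of multivariate polynomials commute. -/
theorem pderiv_pderiv_comm {R σ : Type*} [CommRing R] (i j : σ) (p : MvPolynomial σ R) :
    pderiv i (pderiv j p) = pderiv j (pderiv i p) := by
  classical
  have h : ⁅(pderiv i : Derivation R (MvPolynomial σ R) (MvPolynomial σ R)),
      (pderiv j : Derivation R (MvPolynomial σ R) (MvPolynomial σ R))⁆ = 0 := by
    refine MvPolynomial.derivation_ext fun k => ?_
    rw [Derivation.commutator_apply, pderiv_X, pderiv_X]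
    simp [Pi.single_apply, apply_ite]
  have hp := congrArg (fun D : Derivation R (MvPolynomial σ R) (MvPolynomial σ R) => D p) h
  simpa [Derivation.commutator_apply, sub_eq_zero] using hp

/-- [Y_{jj}, Z_{jj}] = X_{jj}. -/
theorem stmt8 : ∀ m : ℕ, 1 ≤ m → ∀ j : Fin m, ⁅Yjj m j, Zjj m j⁆ = Xjj m j := by
  intro m _ j
  refine LinearMap.ext fun p => ?_
  have hxy := pderiv_pderiv_comm (Sum.inl j) (Sum.inr (Sum.inl j)) p
  have hxz := fun q : PS m => pderiv_pderiv_comm (Sum.inl j) (Sum.inr (Sum.inr j)) q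
  have half : (2 : PS m) * C (1 / 2 : ℂ) = 1 := by
    rw [← map_ofNat C 2, ← C_mul]
    norm_num
  simp only [Ring.lie_def, Yjj, Zjj, Xjj, dx, dy, dz, mx, my, mz, LinearMap.sub_apply,
    LinearMap.add_apply, LinearMap.smul_apply, Module.End.mul_apply, Module.End.one_apply,
    LinearMap.mulLeft_apply, Derivation.coeFn_coe, map_add, map_sub,
    Derivation.leibniz, smul_eq_mul, smul_eq_C_mul, pderiv_C, pderiv_X_self,
    pderiv_X_of_ne (R := ℂ)
      (by simp : (Sum.inr (Sum.inl j) : Fin m ⊕ Fin m ⊕ Fin m) ≠ Sum.inr (Sum.inr j)),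
    pderiv_X_of_ne (R := ℂ)
      (by simp : (Sum.inr (Sum.inr j) : Fin m ⊕ Fin m ⊕ Fin m) ≠ Sum.inr (Sum.inl j)),
    hxy, hxz, mul_zero, add_zero, mul_one]
  generalize C (1 / 2 : ℂ) = c at half ⊢
  grind
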